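/- arXiv:1306.1157 — 3 statements merged into one kernel-verified Lean document; each statement's English description precedes it below -/
import Mathlib

section
/- A network has a k-dimensional vector linear solution over the finite field F_q if and only if it is discrete polymatroidal with respect to a discrete polymatroid D that is representable over F_q and satisfies ρ_max(D) = k. -/
open scoped Classical

structure Network where
  V : Type
  E : Type
  [fintV : Fintype V]
  [fintE : Fintype E]
  hd : E → V
  tl : E → V
  acyclic : ∃ f : V → ℕ, ∀ e : E, f (hd e) < f (tl e)
  demand : V → Set E
  demand_isInput : ∀ v : V, ∀ e ∈ demand v, ∀ e' : E, tl e' ≠ hd e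

namespace Network

variable (N : Network)

instance : Fintype N.V := N.fintV
instance : Fintype N.E := N.fintE

/-- An input edge: its head vertex has in-degree zero. -/
def IsInput (e : N.E) : Prop := ∀ e' : N.E, N.tl e' ≠ N.hd e

/-- The set of input edges, as a type. -/
abbrev InputEdge : Type := {e : N.E // N.IsInput e}

/-- The space of message tuples: input edge `i` generates a row vector of length `k i`. -/
abbrev MsgSpace (F : Type) (k : N.InputEdge → ℕ) : Type :=
  ∀ i : N.InputEdge, Fin (k i) → F

/-- Incoming edges of a vertex. -/
def inSet (v : N.V) : Set N.E := {e | N.tl e = v}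

/-- Outgoing intermediate edges of a vertex, together with its demands. -/
def outSet (v : N.V) : Set N.E :=
  {e | N.hd e = v ∧ ¬ N.IsInput e} ∪ N.demand v

/-- A `(k;n)`-fractional network coding solution over `F`.  The value carried by an input
edge is its message (condition (N1) is thus built in); `φ` gives the values carried by the
intermediate edges; `decode` is condition (N2) and `localEnc` is condition (N3). -/
structure FNCSol (F : Type) [Field F] (k : N.InputEdge → ℕ) (n : ℕ) where
  φ : ∀ e : N.E, ¬ N.IsInput e → N.MsgSpace F k → (Fin n → F)
  decode : ∀ (v : N.V) (j : N.E) (hj : j ∈ N.demand v),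
    ∃ χ : ((∀ i : {i : N.InputEdge // N.tl i.1 = v}, Fin (k i.1) → F) ×
           (∀ e : {e : N.E // N.tl e = v ∧ ¬ N.IsInput e}, Fin n → F)) →
          (Fin (k ⟨j, N.demand_isInput v j hj⟩) → F),
      ∀ x : N.MsgSpace F k,
        χ (fun i => x i.1, fun e => φ e.1 e.2.2 x) = x ⟨j, N.demand_isInput v j hj⟩
  localEnc : ∀ (e : N.E) (he : ¬ N.IsInput e),
    ∃ g : ((∀ i : {i : N.InputEdge // N.tl i.1 = N.hd e}, Fin (k i.1) → F) ×
           (∀ e' : {e' : N.E // N.tl e' = N.hd e ∧ ¬ N.IsInput e'}, Fin n → F)) →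
          (Fin n → F),
      ∀ x : N.MsgSpace F k, φ e he x = g (fun i => x i.1, fun e' => φ e'.1 e'.2.2 x)

/-- A solution is linear if all global encoding functions, all decoding functions and all
local encoding functions are `F`-linear. -/
def FNCSol.IsLinear {N : Network} {F : Type} [Field F] {k : N.InputEdge → ℕ} {n : ℕ}
    (sol : N.FNCSol F k n) : Prop :=
  (∀ (e : N.E) (he : ¬ N.IsInput e), IsLinearMap F (sol.φ e he)) ∧
  (∀ (v : N.V) (j : N.E) (hj : j ∈ N.demand v),
    ∃ χ : ((∀ i : {i : N.InputEdge // N.tl i.1 = v}, Fin (k i.1) → F) ×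
           (∀ e : {e : N.E // N.tl e = v ∧ ¬ N.IsInput e}, Fin n → F)) →
          (Fin (k ⟨j, N.demand_isInput v j hj⟩) → F),
      IsLinearMap F χ ∧
      ∀ x : N.MsgSpace F k,
        χ (fun i => x i.1, fun e => sol.φ e.1 e.2.2 x) = x ⟨j, N.demand_isInput v j hj⟩) ∧
  (∀ (e : N.E) (he : ¬ N.IsInput e),
    ∃ g : ((∀ i : {i : N.InputEdge // N.tl i.1 = N.hd e}, Fin (k i.1) → F) ×
           (∀ e' : {e' : N.E // N.tl e' = N.hd e ∧ ¬ N.IsInput e'}, Fin n → F)) →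
          (Fin n → F),
      IsLinearMap F g ∧
      ∀ x : N.MsgSpace F k, sol.φ e he x = g (fun i => x i.1, fun e' => sol.φ e'.1 e'.2.2 x))

end Network


/-- Sum of the components of `u` indexed by the elements of `A`. -/
noncomputable def setSum {r : ℕ} (u : Fin r → ℕ) (A : Set (Fin r)) : ℕ :=
  ∑ i ∈ Finset.univ.filter (· ∈ A), u i

/-- A discrete polymatroid on the ground set `{1,…,r}` (modelled as `Fin r`). -/
structure DiscretePolymatroid (r : ℕ) where
  carrier : Set (Fin r → ℕ)
  nonempty : carrier.Nonempty
  finite : carrier.Finite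
  lower : ∀ u ∈ carrier, ∀ v : Fin r → ℕ, (∀ i, v i ≤ u i) → v ∈ carrier
  exchange : ∀ u ∈ carrier, ∀ v ∈ carrier, (∑ i, u i) < (∑ i, v i) →
    ∃ w ∈ carrier, (∀ i, u i ≤ w i) ∧ u ≠ w ∧ ∀ i, w i ≤ max (u i) (v i)

namespace DiscretePolymatroid

variable {r : ℕ} (D : DiscretePolymatroid r)

/-- The rank function of a discrete polymatroid. -/
noncomputable def rho (A : Set (Fin r)) : ℕ :=
  D.finite.toFinset.sup fun u => setSum u A

/-- `ρ_max(D) = max_i ρ({i})`. -/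
noncomputable def rhoMax : ℕ := Finset.univ.sup fun i : Fin r => D.rho {i}

/-- The rank of the discrete polymatroid (the common component sum of its basis vectors). -/
noncomputable def rank : ℕ := D.rho Set.univ

end DiscretePolymatroid

/-- The subspaces `V i` of `F^d` represent the rank function `ρ'` when
`dim (∑_{i ∈ X} V i) = ρ'(X)` for every `X`. -/
def RepFnOver (r : ℕ) (ρ' : Set (Fin r) → ℕ) (F : Type) [Field F] : Prop :=
  ∃ (d : ℕ) (V : Fin r → Submodule F (Fin d → F)),
    ∀ X : Set (Fin r), Module.finrank F ↥(⨆ i ∈ X, V i) = ρ' X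

/-- A discrete polymatroid is representable over `F` if its rank function is. -/
def DiscretePolymatroid.RepresentableOver {r : ℕ} (D : DiscretePolymatroid r)
    (F : Type) [Field F] : Prop :=
  RepFnOver r D.rho F

/-- A network is discrete polymatroidal with respect to `D` (conditions (DN1)–(DN3)). -/
def Network.DiscretePolymatroidal (N : Network) {r : ℕ} (D : DiscretePolymatroid r) : Prop :=
  ∃ f : N.E → Fin r,
    (∀ i j : N.InputEdge, f i.1 = f j.1 → i = j) ∧
    ((fun j : Fin r =>
        if j ∈ Set.range (fun i : N.InputEdge => f i.1) then D.rhoMax else 0) ∈ D.carrier) ∧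
    ∀ v : N.V, D.rho (f '' N.inSet v) = D.rho (f '' (N.inSet v ∪ N.outSet v))

/-- `setSum` as a sum of indicator terms. -/
theorem setSum_eq_sum_ite {r : ℕ} (u : Fin r → ℕ) (A : Set (Fin r)) :
    setSum u A = ∑ i, if i ∈ A then u i else 0 := by
  rw [setSum, Finset.sum_filter]

theorem setSum_univ {r : ℕ} (u : Fin r → ℕ) : setSum u Set.univ = ∑ i, u i := by
  simp [setSum]

theorem setSum_union_add_inter {r : ℕ} (u : Fin r → ℕ) (A B : Set (Fin r)) :
    setSum u (A ∪ B) + setSum u (A ∩ B) = setSum u A + setSum u B := by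
  simp only [setSum_eq_sum_ite, ← Finset.sum_add_distrib]
  refine Finset.sum_congr rfl fun i _ => ?_
  by_cases hA : i ∈ A <;> by_cases hB : i ∈ B <;> simp [hA, hB]

theorem setSum_add_single {r : ℕ} (u : Fin r → ℕ) (i : Fin r) (A : Set (Fin r)) :
    setSum (u + Pi.single i 1) A = setSum u A + if i ∈ A then 1 else 0 := by
  simp only [setSum, Pi.add_apply, Finset.sum_add_distrib]
  simp [Pi.single_apply, Finset.sum_ite_eq']

theorem setSum_mono_left {r : ℕ} {u v : Fin r → ℕ} (h : ∀ i, u i ≤ v i) (A : Set (Fin r)) :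
    setSum u A ≤ setSum v A :=
  Finset.sum_le_sum fun i _ => h i

theorem setSum_const_of_mem {r k : ℕ} (R A : Set (Fin r)) [DecidablePred (· ∈ R)] :
    setSum (fun j => if j ∈ R then k else 0) A = (A ∩ R).ncard * k := by
  rw [setSum, ← Finset.sum_filter, Finset.filter_filter, Finset.sum_const, smul_eq_mul,
    Set.ncard_eq_toFinset_card']
  congr 2
  ext
  simp

/-- The integer points of the polymatroid polytope of a set function. -/
def polymatroidPoints {r : ℕ} (ρ : Set (Fin r) → ℕ) : Set (Fin r → ℕ) :=
  {u | ∀ A, setSum u A ≤ ρ A}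

/-- If no coordinate in `B` can be increased, then `B` lies in a tight set. -/
theorem exists_tight_of_saturated {r : ℕ} {ρ : Set (Fin r) → ℕ} (h0 : ρ ∅ = 0)
    (hsub : ∀ A B, ρ (A ∪ B) + ρ (A ∩ B) ≤ ρ A + ρ B) {u : Fin r → ℕ}
    (hu : u ∈ polymatroidPoints ρ) (B : Set (Fin r))
    (hB : ∀ i ∈ B, u + Pi.single i 1 ∉ polymatroidPoints ρ) :
    ∃ T, B ⊆ T ∧ setSum u T = ρ T := by
  induction B, B.toFinite using Set.Finite.induction_on with
  | empty => exact ⟨∅, subset_rfl, by rw [h0]; simp [setSum]⟩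
  | @insert i B _ _ ih =>
    obtain ⟨T, hBT, hT⟩ := ih fun j hj => hB j (Set.mem_insert_of_mem _ hj)
    have hi := hB i (Set.mem_insert _ _)
    simp only [polymatroidPoints, Set.mem_ofPred_eq, not_forall, not_le, setSum_add_single] at hi
    obtain ⟨A, hA⟩ := hi
    have hAle := hu A
    have hiA : i ∈ A := by
      by_contra h
      simp only [h, if_false] at hA
      omega
    simp only [hiA, if_true] at hA
    refine ⟨A ∪ T, Set.insert_subset (Or.inl hiA) (hBT.trans Set.subset_union_right), ?_⟩
    have h1 := setSum_union_add_inter u A T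
    have h2 := hsub A T
    have h3 := hu (A ∪ T)
    have h4 := hu (A ∩ T)
    omega

theorem finite_polymatroidPoints {r : ℕ} (ρ : Set (Fin r) → ℕ) :
    (polymatroidPoints ρ).Finite := by
  refine (Set.finite_Iic fun i => ρ {i}).subset fun u hu i => ?_
  simpa [setSum_eq_sum_ite] using hu {i}

/-- The discrete polymatroid of a normalized submodular function. -/
def DiscretePolymatroid.ofSubmodular {r : ℕ} (ρ : Set (Fin r) → ℕ) (h0 : ρ ∅ = 0)
    (hsub : ∀ A B, ρ (A ∪ B) + ρ (A ∩ B) ≤ ρ A + ρ B) : DiscretePolymatroid r where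
  carrier := polymatroidPoints ρ
  nonempty := ⟨0, fun A => by simp [setSum]⟩
  finite := finite_polymatroidPoints ρ
  lower u hu v hv A := (setSum_mono_left hv A).trans (hu A)
  exchange u hu v hv huv := by
    by_cases h : ∃ i, u i < v i ∧ u + Pi.single i 1 ∈ polymatroidPoints ρ
    · obtain ⟨i, hi, hmem⟩ := h
      refine ⟨_, hmem, fun j => Nat.le_add_right _ _, fun he => ?_, fun j => ?_⟩
      · simpa using congrFun he i
      · by_cases hj : j = i
        · subst hj
          simp
          omega
        · simp [hj]
    · push Not at h
      obtain ⟨T, hT, htight⟩ := exists_tight_of_saturated h0 hsub hu {i | u i < v i} h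
      refine absurd huv (not_lt.2 ?_)
      have hv' : setSum v Tᶜ ≤ setSum u Tᶜ := Finset.sum_le_sum fun i hi => by
        simp only [Finset.mem_filter, Set.mem_compl_iff] at hi
        exact not_lt.1 fun hlt => hi.2 (hT hlt)
      have hsum (w : Fin r → ℕ) : ∑ i, w i = setSum w T + setSum w Tᶜ := by
        simpa [setSum_univ, setSum] using setSum_union_add_inter w T Tᶜ
      have := hv T
      rw [hsum u, hsum v]
      omega

theorem DiscretePolymatroid.rho_ofSubmodular {r : ℕ} (ρ : Set (Fin r) → ℕ) (h0 : ρ ∅ = 0)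
    (hsub : ∀ A B, ρ (A ∪ B) + ρ (A ∩ B) ≤ ρ A + ρ B) (hmono : Monotone ρ) (A : Set (Fin r)) :
    (DiscretePolymatroid.ofSubmodular ρ h0 hsub).rho A = ρ A := by
  apply le_antisymm
  · exact Finset.sup_le fun u hu => (Set.Finite.mem_toFinset _).1 hu A
  · let S : Set (Fin r → ℕ) := {u | u ∈ polymatroidPoints ρ ∧ ∀ i ∉ A, u i = 0}
    have hS : S.Finite := (finite_polymatroidPoints ρ).subset fun u hu => hu.1
    obtain ⟨u, hu, hmax⟩ := S.exists_max_image (fun u => setSum u A) hS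
      ⟨0, fun A => by simp [setSum], fun _ _ => rfl⟩
    obtain ⟨T, hT, htight⟩ := exists_tight_of_saturated h0 hsub hu.1 A fun i hi hmem => by
      have := hmax (u + Pi.single i 1) ⟨hmem, fun j hj => by
        have : j ≠ i := fun h => hj (h ▸ hi)
        simp [this, hu.2 j hj]⟩
      simp [setSum_add_single, hi] at this
    have hTA : setSum u T = setSum u A := by
      simp only [setSum_eq_sum_ite]
      refine Finset.sum_congr rfl fun i _ => ?_
      by_cases hi : i ∈ A
      · simp [hi, hT hi]
      · simp [hi, hu.2 i hi]
    calc ρ A ≤ ρ T := hmono hT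
      _ = setSum u A := by rw [← htight, hTA]
      _ ≤ _ := Finset.le_sup (f := fun u => setSum u A) ((Set.Finite.mem_toFinset _).2 hu.1)

theorem DiscretePolymatroid.setSum_le_rho {r : ℕ} (D : DiscretePolymatroid r) {u : Fin r → ℕ}
    (hu : u ∈ D.carrier) (A : Set (Fin r)) : setSum u A ≤ D.rho A :=
  Finset.le_sup (f := fun u => setSum u A) ((Set.Finite.mem_toFinset _).2 hu)

/-- Every finite family of subspaces represents a discrete polymatroid. -/
theorem exists_discretePolymatroid_of_subspaces {r : ℕ} {F M : Type} [Field F] [AddCommGroup M]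
    [Module F M] [FiniteDimensional F M] (V : Fin r → Submodule F M) :
    ∃ D : DiscretePolymatroid r, D.RepresentableOver F ∧
      (∀ X, D.rho X = Module.finrank F ↥(⨆ i ∈ X, V i)) ∧
      ∀ u, (∀ A, setSum u A ≤ D.rho A) → u ∈ D.carrier := by
  let ρ : Set (Fin r) → ℕ := fun X => Module.finrank F ↥(⨆ i ∈ X, V i)
  have h0 : ρ ∅ = 0 := by simp [ρ]
  have hmono : Monotone ρ := fun A B h => Submodule.finrank_mono (biSup_mono fun i hi => h hi)
  have hsub : ∀ A B, ρ (A ∪ B) + ρ (A ∩ B) ≤ ρ A + ρ B := fun A B => by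
    simp only [ρ]
    rw [← Submodule.finrank_sup_add_finrank_inf_eq (⨆ i ∈ A, V i), iSup_union]
    gcongr
    exact Submodule.finrank_mono
      (le_inf (biSup_mono fun i hi => hi.1) (biSup_mono fun i hi => hi.2))
  have hrho := DiscretePolymatroid.rho_ofSubmodular ρ h0 hsub hmono
  refine ⟨.ofSubmodular ρ h0 hsub, ?_, hrho, fun u hu A => (hu A).trans (hrho A).le⟩
  let φ := (Module.finBasis F M).equivFun
  refine ⟨_, fun i => (V i).map φ.toLinearMap, fun X => ?_⟩
  have hmap : ⨆ i ∈ X, (V i).map φ.toLinearMap = (⨆ i ∈ X, V i).map φ.toLinearMap := by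
    simp only [Submodule.map_iSup]
  rw [hrho, hmap]
  exact LinearEquiv.finrank_map_eq φ _

/-- A linear map factors linearly through another one with smaller kernel. -/
theorem LinearMap.exists_comp_eq_of_ker_le {F A B C : Type} [Field F] [AddCommGroup A]
    [Module F A] [AddCommGroup B] [Module F B] [AddCommGroup C] [Module F C]
    (T : A →ₗ[F] B) (S : A →ₗ[F] C) (h : LinearMap.ker T ≤ LinearMap.ker S) :
    ∃ g : B →ₗ[F] C, g ∘ₗ T = S := by
  obtain ⟨l, hl⟩ := ((LinearMap.ker T).liftQ T le_rfl).exists_leftInverse_of_injective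
    (Submodule.ker_liftQ_eq_bot _ _ _ le_rfl)
  refine ⟨(LinearMap.ker T).liftQ S h ∘ₗ l, ?_⟩
  ext x
  have := LinearMap.congr_fun hl ((LinearMap.ker T).mkQ x)
  simp at this
  simp [this]

/-- A subspace of dimension at most `k` is spanned by `k` vectors. -/
theorem Submodule.exists_fin_span_eq {F M : Type} [Field F] [AddCommGroup M] [Module F M]
    [FiniteDimensional F M] (W : Submodule F M) {k : ℕ} (h : Module.finrank F W ≤ k) :
    ∃ w : Fin k → M, Submodule.span F (Set.range w) = W := by
  let b := Module.finBasis F W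
  refine ⟨fun a => if ha : a.1 < Module.finrank F W then b ⟨a, ha⟩ else 0, le_antisymm ?_ ?_⟩
  · rw [Submodule.span_le]
    rintro _ ⟨a, rfl⟩
    dsimp only
    split_ifs
    · exact (b _).2
    · exact W.zero_mem
  · have hb : Submodule.span F (Set.range fun i => (b i : M)) = W := by
      have := congrArg (Submodule.map W.subtype) b.span_eq
      rwa [Submodule.map_span, ← Set.range_comp, Submodule.map_top,
        Submodule.range_subtype] at this
    conv_lhs => rw [← hb]
    refine Submodule.span_mono ?_
    rintro _ ⟨i, rfl⟩
    exact ⟨⟨i, i.2.trans_le h⟩, by simp⟩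

/-- A linear network code, given by its encoding maps on all edges, exists exactly when each
outgoing map kills the messages that all incoming maps kill. -/
theorem Network.exists_isLinear_iff (N : Network) (F : Type) [Field F] (k : ℕ) :
    (∃ sol : N.FNCSol F (fun _ => k) k, sol.IsLinear) ↔
    ∃ ψ : N.E → N.MsgSpace F (fun _ => k) →ₗ[F] (Fin k → F),
      (∀ i : N.InputEdge, ψ i.1 = LinearMap.proj i) ∧
      ∀ v, ∀ e ∈ N.outSet v, ⨅ e' ∈ N.inSet v, LinearMap.ker (ψ e') ≤ LinearMap.ker (ψ e) := by
  constructor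
  · rintro ⟨sol, hφ, hdec, henc⟩
    let ψ : N.E → N.MsgSpace F (fun _ => k) →ₗ[F] (Fin k → F) := fun e =>
      if h : N.IsInput e then LinearMap.proj (⟨e, h⟩ : N.InputEdge) else (hφ e h).mk'
    have hin (i : N.InputEdge) : ψ i.1 = LinearMap.proj i := by simp [ψ, i.2]
    have hnin (e : N.E) (h : ¬ N.IsInput e) (x) : ψ e x = sol.φ e h x := by simp [ψ, h]
    refine ⟨ψ, hin, fun v e he x hx => ?_⟩
    simp only [Submodule.mem_iInf, LinearMap.mem_ker] at hx ⊢
    have hx1 : (fun i : {i : N.InputEdge // N.tl i.1 = v} => x i.1) = 0 := by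
      ext1 i
      simpa [hin] using hx i.1.1 i.2
    have hx2 : (fun e : {e : N.E // N.tl e = v ∧ ¬ N.IsInput e} => sol.φ e.1 e.2.2 x) = 0 := by
      ext1 e
      simpa [hnin e.1 e.2.2] using hx e.1 e.2.1
    rcases he with ⟨rfl, he⟩ | he
    · obtain ⟨g, hg, hgx⟩ := henc e he
      rw [hnin e he, hgx, hx1, hx2]
      exact hg.map_zero
    · obtain ⟨χ, hχ, hχx⟩ := hdec v e he
      have := hχx x
      rw [hx1, hx2] at this
      rw [hin ⟨e, N.demand_isInput v e he⟩, LinearMap.proj_apply, ← this]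
      exact hχ.map_zero
  · rintro ⟨ψ, hin, hout⟩
    let obs (v : N.V) : N.MsgSpace F (fun _ => k) →ₗ[F]
        (∀ i : {i : N.InputEdge // N.tl i.1 = v}, Fin k → F) ×
           (∀ e : {e : N.E // N.tl e = v ∧ ¬ N.IsInput e}, Fin k → F) :=
      (LinearMap.pi fun i => LinearMap.proj i.1).prod (LinearMap.pi fun e => ψ e.1)
    have key (v : N.V) (e : N.E) (he : e ∈ N.outSet v) : ∃ g, IsLinearMap F g ∧
        ∀ x, g (obs v x) = ψ e x := by
      obtain ⟨g, hg⟩ := (obs v).exists_comp_eq_of_ker_le (ψ e) <| by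
        refine le_trans ?_ (hout v e he)
        refine le_iInf₂ fun e' he' x hx => ?_
        have hx' : obs v x = 0 := hx
        by_cases hi : N.IsInput e'
        · have := congrFun (congrArg Prod.fst hx') ⟨⟨e', hi⟩, he'⟩
          rw [LinearMap.mem_ker, hin ⟨e', hi⟩]
          exact this
        · exact congrFun (congrArg Prod.snd hx') ⟨e', he', hi⟩
      exact ⟨g, g.isLinear, fun x => LinearMap.congr_fun hg x⟩
    have hdec (v : N.V) (j : N.E) (hj : j ∈ N.demand v) : ∃ χ, IsLinearMap F χ ∧
        ∀ x, χ (obs v x) = x ⟨j, N.demand_isInput v j hj⟩ := by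
      obtain ⟨χ, hχ, h⟩ := key v j (Or.inr hj)
      exact ⟨χ, hχ, fun x => by rw [h, hin ⟨j, N.demand_isInput v j hj⟩, LinearMap.proj_apply]⟩
    have henc (e : N.E) (he : ¬ N.IsInput e) : ∃ g, IsLinearMap F g ∧
        ∀ x, ψ e x = g (obs (N.hd e) x) := by
      obtain ⟨g, hg, h⟩ := key (N.hd e) e (Or.inl ⟨rfl, he⟩)
      exact ⟨g, hg, fun x => (h x).symm⟩
    exact ⟨⟨fun e _ => ψ e, fun v j hj => (hdec v j hj).imp fun _ h => h.2,
      fun e he => (henc e he).imp fun _ h => h.2⟩, fun e _ => (ψ e).isLinear, hdec, henc⟩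

/-- The row spaces of the input edges in `A` span a space of dimension `|A| * k`. -/
theorem Network.ncard_mul_le_finrank_iSup_range_dualMap (N : Network) (F : Type) [Field F]
    (k : ℕ) (A : Set N.InputEdge) :
    A.ncard * k ≤ Module.finrank F ↥(⨆ i ∈ A, LinearMap.range
      (LinearMap.proj i : N.MsgSpace F (fun _ => k) →ₗ[F] (Fin k → F)).dualMap) := by
  let c : A × Fin k → Module.Dual F (N.MsgSpace F fun _ => k) := fun p =>
    (LinearMap.proj p.1.1 : N.MsgSpace F (fun _ => k) →ₗ[F] (Fin k → F)).dualMap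
      (LinearMap.proj p.2)
  have hc : LinearIndependent F c := by
    rw [Fintype.linearIndependent_iff]
    intro g hg p
    have := LinearMap.congr_fun hg (Pi.single p.1.1 (Pi.single p.2 1))
    rw [LinearMap.sum_apply, Finset.sum_eq_single p] at this
    · simpa [c] using this
    · rintro q - hq
      by_cases h1 : q.1 = p.1
      · have h2 : q.2 ≠ p.2 := fun h => hq (Prod.ext h1 h)
        simp [c, h1, h2]
      · have h1' : q.1.1 ≠ p.1.1 := fun h => h1 (Subtype.ext h)
        simp [c, h1']
    · simp
  calc A.ncard * k = Module.finrank F (Submodule.span F (Set.range c)) := by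
        rw [finrank_span_eq_card hc, Fintype.card_prod, Fintype.card_fin,
          ← Nat.card_eq_fintype_card, Nat.card_coe_set_eq]
    _ ≤ _ := by
        refine Submodule.finrank_mono (Submodule.span_le.2 ?_)
        rintro _ ⟨p, rfl⟩
        exact Submodule.mem_iSup_of_mem p.1.1 (Submodule.mem_iSup_of_mem p.1.2 ⟨_, rfl⟩)

theorem Network.exists_isInput (N : Network) [Nonempty N.E] : ∃ e, N.IsInput e := by
  obtain ⟨h, hh⟩ := N.acyclic
  obtain ⟨e, he⟩ := Finite.exists_min fun e => h (N.hd e)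
  refine ⟨e, fun e' h' => ?_⟩
  have h1 := hh e'
  have h2 := he e'
  rw [h'] at h1
  omega

theorem Network.exists_discretePolymatroidal_of_isEmpty (N : Network) [IsEmpty N.E] (F : Type)
    [Field F] (k : ℕ) :
    ∃ (r : ℕ) (_ : 0 < r) (D : DiscretePolymatroid r),
      D.RepresentableOver F ∧ D.rhoMax = k ∧ N.DiscretePolymatroidal D := by
  obtain ⟨D, hD, hrho, hmem⟩ :=
    exists_discretePolymatroid_of_subspaces (F := F) (M := Fin k → F) (r := 1) fun _ => ⊤
  refine ⟨1, one_pos, D, hD, ?_, isEmptyElim, fun i => isEmptyElim i.1, ?_, fun v => ?_⟩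
  · have h : D.rho {0} = k := by rw [hrho, iSup_singleton, finrank_top, Module.finrank_fin_fun]
    simpa [DiscretePolymatroid.rhoMax] using h
  · exact hmem _ fun A => by simp [setSum]
  · rw [Set.eq_empty_of_isEmpty (N.inSet v ∪ N.outSet v), Set.eq_empty_of_isEmpty (N.inSet v)]

/-- Encoding maps of a linear solution give a representable discrete polymatroid. -/
theorem Network.exists_discretePolymatroidal_of_encoding (N : Network) [Nonempty N.E] {F : Type}
    [Field F] {k : ℕ} (ψ : N.E → N.MsgSpace F (fun _ => k) →ₗ[F] (Fin k → F))
    (hin : ∀ i : N.InputEdge, ψ i.1 = LinearMap.proj i)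
    (hout : ∀ v, ∀ e ∈ N.outSet v,
      ⨅ e' ∈ N.inSet v, LinearMap.ker (ψ e') ≤ LinearMap.ker (ψ e)) :
    ∃ (r : ℕ) (_ : 0 < r) (D : DiscretePolymatroid r),
      D.RepresentableOver F ∧ D.rhoMax = k ∧ N.DiscretePolymatroidal D := by
  let W : N.E → Submodule F (Module.Dual F (N.MsgSpace F fun _ => k)) := fun e =>
    LinearMap.range (ψ e).dualMap
  have hW (e : N.E) : W e = (LinearMap.ker (ψ e)).dualAnnihilator :=
    LinearMap.range_dualMap_eq_dualAnnihilator_ker _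
  have hWk (e : N.E) : Module.finrank F (W e) ≤ k :=
    (LinearMap.finrank_range_le _).trans_eq <| by
      rw [Subspace.dual_finrank_eq, Module.finrank_fin_fun]
  have hWin (A : Set N.InputEdge) :
      A.ncard * k ≤ Module.finrank F ↥(⨆ i ∈ A, W i.1) := by
    have h (i : N.InputEdge) : W i.1 = LinearMap.range
        (LinearMap.proj i : N.MsgSpace F (fun _ => k) →ₗ[F] (Fin k → F)).dualMap := by
      simp only [W, hin]
    rw [iSup_congr fun i => iSup_congr fun _ => h i]
    exact N.ncard_mul_le_finrank_iSup_range_dualMap F k A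
  have hWout (v : N.V) (e : N.E) (he : e ∈ N.outSet v) : W e ≤ ⨆ e' ∈ N.inSet v, W e' := by
    rw [hW, iSup_subtype']
    simp only [hW]
    rw [← Subspace.dualAnnihilator_iInf_eq]
    refine Submodule.dualAnnihilator_anti ?_
    rw [iInf_subtype]
    exact hout v e he
  let f := Fintype.equivFin N.E
  obtain ⟨D, hD, hrho, hmem⟩ := exists_discretePolymatroid_of_subspaces fun j => W (f.symm j)
  have hrho' (A : Set N.E) : D.rho (f '' A) = Module.finrank F ↥(⨆ e ∈ A, W e) := by
    rw [hrho, iSup_image,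
      iSup_congr fun e => iSup_congr fun _ => congrArg W (f.symm_apply_apply e)]
  have hmax : D.rhoMax = k := by
    apply le_antisymm
    · refine Finset.sup_le fun j _ => ?_
      rw [hrho, iSup_singleton]
      exact hWk _
    · obtain ⟨e, he⟩ := N.exists_isInput
      refine le_trans ?_ (Finset.le_sup (Finset.mem_univ (f e)))
      have h := hWin {⟨e, he⟩}
      rw [iSup_singleton, Set.ncard_singleton, one_mul] at h
      rwa [hrho, iSup_singleton, Equiv.symm_apply_apply]
  refine ⟨_, Fintype.card_pos, D, hD, hmax, f, fun i j h => Subtype.ext (f.injective h), ?_,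
    fun v => ?_⟩
  · refine hmem _ fun A => ?_
    rw [setSum_const_of_mem, hmax]
    let g : N.InputEdge → Fin (Fintype.card N.E) := fun i => f i.1
    have hg : g.Injective := f.injective.comp Subtype.val_injective
    have hA : A ∩ Set.range g = g '' (g ⁻¹' A) := (Set.image_preimage_eq_inter_range).symm
    change (A ∩ Set.range g).ncard * k ≤ _
    rw [hA, Set.ncard_image_of_injective _ hg]
    refine (hWin _).trans ?_
    rw [hrho]
    refine Submodule.finrank_mono (iSup₂_le fun i hi => ?_)
    refine le_trans ?_ (le_iSup₂ (f i.1) hi)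
    rw [Equiv.symm_apply_apply]
  · rw [hrho', hrho', iSup_union, sup_eq_left.2 (iSup₂_le (hWout v))]

/-- A representable discrete polymatroid gives the encoding maps of a linear solution. -/
theorem Network.exists_encoding_of_discretePolymatroidal (N : Network) {F : Type} [Field F]
    {r : ℕ} (D : DiscretePolymatroid r) (hD : D.RepresentableOver F)
    (hN : N.DiscretePolymatroidal D) :
    ∃ ψ : N.E → N.MsgSpace F (fun _ => D.rhoMax) →ₗ[F] (Fin D.rhoMax → F),
      (∀ i : N.InputEdge, ψ i.1 = LinearMap.proj i) ∧
      ∀ v, ∀ e ∈ N.outSet v, ⨅ e' ∈ N.inSet v, LinearMap.ker (ψ e') ≤ LinearMap.ker (ψ e) := by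
  obtain ⟨d, V, hV⟩ := hD
  obtain ⟨f, hf, hbasis, hf3⟩ := hN
  have hVk (j : Fin r) : Module.finrank F (V j) ≤ D.rhoMax := by
    have h1 := hV {j}
    rw [iSup_singleton] at h1
    exact h1.trans_le (Finset.le_sup (f := fun j => D.rho {j}) (Finset.mem_univ j))
  choose w hw using fun e : N.E => (V (f e)).exists_fin_span_eq (hVk (f e))
  let c : N.InputEdge × Fin D.rhoMax → Fin d → F := fun p => w p.1.1 p.2
  have hc : LinearIndependent F c := by
    rw [linearIndependent_iff_card_le_finrank_span]
    let g : N.InputEdge → Fin r := fun i => f i.1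
    have h1 := D.setSum_le_rho hbasis (Set.range g)
    rw [setSum_const_of_mem, ← hV] at h1
    change (Set.range g ∩ Set.range g).ncard * _ ≤ _ at h1
    rw [Set.inter_self, ← Set.image_univ, Set.ncard_image_of_injective _ fun i j => hf i j,
      Set.ncard_univ, Nat.card_eq_fintype_card, iSup_image] at h1
    rw [Fintype.card_prod, Fintype.card_fin]
    refine h1.trans (Submodule.finrank_mono (iSup₂_le fun i _ => ?_))
    rw [← hw i.1]
    refine Submodule.span_mono ?_
    rintro _ ⟨a, rfl⟩
    exact ⟨(i, a), rfl⟩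
  obtain ⟨l, hl⟩ := (Fintype.linearCombination F c).exists_leftInverse_of_injective
    (LinearMap.ker_eq_bot.2 (linearIndependent_iff_injective_fintypeLinearCombination.1 hc))
  have hlc (p : N.InputEdge × Fin D.rhoMax) : l (c p) = Pi.single p 1 := by
    have := LinearMap.congr_fun hl (Pi.single p 1)
    simpa [Fintype.linearCombination_apply_single] using this
  -- a section of the map sending a functional to its values on the input vectors
  let s : N.MsgSpace F (fun _ => D.rhoMax) → (Fin d → F) →ₗ[F] F := fun x =>
    (Fintype.linearCombination F fun p : N.InputEdge × Fin D.rhoMax => x p.1 p.2) ∘ₗ l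
  let ψ (e : N.E) : N.MsgSpace F (fun _ => D.rhoMax) →ₗ[F] (Fin D.rhoMax → F) :=
    { toFun := fun x a => s x (w e a)
      map_add' := fun x y => by
        ext a
        simp [s, Fintype.linearCombination_apply, mul_add, Finset.sum_add_distrib]
      map_smul' := fun t x => by
        ext a
        simp [s, Fintype.linearCombination_apply, Finset.mul_sum, mul_left_comm] }
  have hker (e : N.E) (x) : x ∈ LinearMap.ker (ψ e) ↔ V (f e) ≤ LinearMap.ker (s x) := by
    rw [← hw e, Submodule.span_le, Set.range_subset_iff, LinearMap.mem_ker, funext_iff]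
    rfl
  refine ⟨ψ, fun i => ?_, fun v e he x hx => ?_⟩
  · refine LinearMap.ext fun x => ?_
    ext a
    change s x (c (i, a)) = x i a
    simp [s, hlc]
  · simp only [Submodule.mem_iInf, hker] at hx ⊢
    have h := hf3 v
    rw [← hV, ← hV] at h
    have hspan := Submodule.eq_of_le_of_finrank_eq
      (biSup_mono fun j hj => Set.image_mono Set.subset_union_left hj) h
    have hle : V (f e) ≤ ⨆ j ∈ f '' (N.inSet v ∪ N.outSet v), V j :=
      le_iSup₂ (f := fun j _ => V j) (f e) ⟨e, Or.inr he, rfl⟩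
    rw [← hspan, iSup_image] at hle
    exact hle.trans (iSup₂_le hx)

/-- **Theorem 1.** A network has a `k`-dimensional vector linear solution over `F_q` if and
only if it is discrete polymatroidal with respect to a discrete polymatroid representable
over `F_q` with `ρ_max(D) = k`. -/
theorem vectorLinearSolvable_iff_discretePolymatroidal
    (N : Network) (F : Type) [Field F] [Fintype F] (k : ℕ) (hk : 0 < k) :
    (∃ sol : N.FNCSol F (fun _ => k) k, sol.IsLinear) ↔
    ∃ (r : ℕ) (_ : 0 < r) (D : DiscretePolymatroid r),
      D.RepresentableOver F ∧ D.rhoMax = k ∧ N.DiscretePolymatroidal D := by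
  rw [N.exists_isLinear_iff]
  constructor
  · rintro ⟨ψ, hin, hout⟩
    cases isEmpty_or_nonempty N.E
    · exact N.exists_discretePolymatroidal_of_isEmpty F k
    · exact N.exists_discretePolymatroidal_of_encoding ψ hin hout
  · rintro ⟨r, -, D, hD, rfl, hN⟩
    exact N.exists_encoding_of_discretePolymatroidal D hD hN
end

section
/- A network has a scalar linear solution over the finite field F_q if and only if it is matroidal with respect to a matroid representable over F_q. -/
open scoped Classical

/-- A matroid on the ground set `{1,…,r}`, described by its rank function
(conditions (D1)–(D3) together with `rk X ≤ |X|`). -/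
structure MatroidOn (r : ℕ) where
  rk : Set (Fin r) → ℕ
  rk_empty : rk ∅ = 0
  rk_mono : ∀ A B : Set (Fin r), A ⊆ B → rk A ≤ rk B
  rk_submodular : ∀ A B : Set (Fin r), rk (A ∪ B) + rk (A ∩ B) ≤ rk A + rk B
  rk_le_card : ∀ A : Set (Fin r), rk A ≤ A.ncard

/-- Independent sets of a matroid. -/
def MatroidOn.Indep {r : ℕ} (M : MatroidOn r) (A : Set (Fin r)) : Prop := M.rk A = A.ncard

/-- A matroid is representable over `F` if there are one-dimensional subspaces
`V_1,…,V_r` of a finite-dimensional `F`-vector space with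
`dim (∑_{i ∈ X} V i) = rk X` for every `X`. -/
def MatroidOn.RepresentableOver {r : ℕ} (M : MatroidOn r) (F : Type) [Field F] : Prop :=
  ∃ (d : ℕ) (V : Fin r → Submodule F (Fin d → F)),
    (∀ i : Fin r, Module.finrank F ↥(V i) = 1) ∧
    ∀ X : Set (Fin r), Module.finrank F ↥(⨆ i ∈ X, V i) = M.rk X

/-- A network is matroidal with respect to the matroid `M`. -/
def Network.Matroidal (N : Network) {r : ℕ} (M : MatroidOn r) : Prop :=
  ∃ f : N.E → Fin r,
    (∀ i j : N.InputEdge, f i.1 = f j.1 → i = j) ∧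
    M.Indep (Set.range fun i : N.InputEdge => f i.1) ∧
    ∀ v : N.V, M.rk (f '' N.inSet v) = M.rk (f '' (N.inSet v ∪ N.outSet v))

namespace Network

/-- A family of coefficient vectors, one per edge, describing a scalar linear network code:
the value carried by `e` is the dot product of `c e` with the message tuple. -/
structure IsCodingFamily (N : Network) {F : Type} [Field F] (c : N.E → N.InputEdge → F) :
    Prop where
  input : ∀ i : N.InputEdge, c i.1 = Pi.single i 1
  mem_span : ∀ v : N.V, ∀ e ∈ N.outSet v, c e ∈ Submodule.span F (c '' N.inSet v)

theorem mem_span_image_iff_dotProduct {ι α K : Type*} [Field K] [Fintype ι]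
    (c : α → ι → K) (S : Set α) (u : ι → K) :
    u ∈ Submodule.span K (c '' S) ↔
      ∀ y : ι → K, (∀ a ∈ S, c a ⬝ᵥ y = 0) → u ⬝ᵥ y = 0 := by
  constructor
  · intro hu y hy
    have hle : Submodule.span K (c '' S) ≤ LinearMap.ker (dotProductEquiv K ι y) := by
      rw [Submodule.span_le]
      rintro _ ⟨a, ha, rfl⟩
      simpa [dotProduct_comm] using hy a ha
    simpa [dotProduct_comm] using hle hu
  · intro h
    by_contra hu
    obtain ⟨g, hg, hle⟩ := Submodule.exists_le_ker_of_notMem hu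
    obtain ⟨y, rfl⟩ := (dotProductEquiv K ι).surjective g
    refine hg ?_
    have := h y fun a ha => by
      simpa [dotProduct_comm] using hle (Submodule.subset_span ⟨a, ha, rfl⟩)
    simpa [dotProduct_comm] using this

/-- The values received at a vertex, as a linear function of the messages. -/
noncomputable def received (N : Network) {F : Type} [Field F] (c : N.E → N.InputEdge → F)
    (v : N.V) : N.MsgSpace F (fun _ => 1) →ₗ[F]
      ((∀ _ : {i : N.InputEdge // N.tl i.1 = v}, Fin 1 → F) ×
        (∀ _ : {e : N.E // N.tl e = v ∧ ¬ N.IsInput e}, Fin 1 → F)) where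
  toFun x := (fun i => x i.1, fun e _ => c e.1 ⬝ᵥ fun i => x i 0)
  map_add' x y := by
    refine Prod.ext rfl ?_
    funext e t
    exact dotProduct_add _ (fun i => x i 0) (fun i => y i 0)
  map_smul' a x := by
    refine Prod.ext rfl ?_
    funext e t
    exact dotProduct_smul a _ (fun i => x i 0)

theorem IsCodingFamily.exists_comp_received {N : Network} {F : Type} [Field F]
    {c : N.E → N.InputEdge → F} (hc : N.IsCodingFamily c) {v : N.V} {e : N.E}
    (he : e ∈ N.outSet v) :
    ∃ g : ((∀ _ : {i : N.InputEdge // N.tl i.1 = v}, Fin 1 → F) ×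
        (∀ _ : {e : N.E // N.tl e = v ∧ ¬ N.IsInput e}, Fin 1 → F)) → (Fin 1 → F),
      IsLinearMap F g ∧
        ∀ x : N.MsgSpace F (fun _ => 1),
          g (N.received c v x) = fun _ => c e ⬝ᵥ fun i => x i 0 := by
  let p : Module.Dual F (N.MsgSpace F (fun _ => 1)) :=
    { toFun := fun x => c e ⬝ᵥ fun i => x i 0
      map_add' := fun x y => dotProduct_add _ (fun i => x i 0) (fun i => y i 0)
      map_smul' := fun a x => dotProduct_smul a _ (fun i => x i 0) }
  have hp : p ∈ LinearMap.range (N.received c v).dualMap := by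
    rw [LinearMap.range_dualMap_eq_dualAnnihilator_ker, Submodule.mem_dualAnnihilator]
    intro x hx
    have hx : N.received c v x = 0 := hx
    refine (mem_span_image_iff_dotProduct c _ _).1 (hc.mem_span v e he) _ fun a ha => ?_
    by_cases hin : N.IsInput a
    · have h := congrFun (congrFun (congrArg Prod.fst hx) ⟨⟨a, hin⟩, ha⟩) 0
      rw [hc.input ⟨a, hin⟩, single_one_dotProduct]
      exact h
    · exact congrFun (congrFun (congrArg Prod.snd hx) ⟨a, ha, hin⟩) 0
  obtain ⟨g, hg⟩ := hp
  refine ⟨fun y _ => g y, ⟨fun x y => ?_, fun a x => ?_⟩, fun x => ?_⟩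
  · funext t; exact map_add g x y
  · funext t; exact map_smul g a x
  · funext t; exact LinearMap.congr_fun hg x

theorem exists_isLinear_iff_exists_isCodingFamily (N : Network) {F : Type} [Field F] :
    (∃ sol : N.FNCSol F (fun _ => 1) 1, sol.IsLinear) ↔
      ∃ c : N.E → N.InputEdge → F, N.IsCodingFamily c := by
  constructor
  · rintro ⟨sol, hφ, hdec, hloc⟩
    let c : N.E → N.InputEdge → F := fun e =>
      if he : N.IsInput e then Pi.single ⟨e, he⟩ 1
      else fun i => sol.φ e he (fun j _ => Pi.single (M := fun _ => F) i 1 j) 0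
    have hin : ∀ i : N.InputEdge, c i.1 = Pi.single i 1 := fun i => dif_pos i.2
    have hval : ∀ (e : N.E) (he : ¬ N.IsInput e) (y : N.InputEdge → F),
        sol.φ e he (fun j _ => y j) = fun _ => c e ⬝ᵥ y := by
      intro e he y
      let L : (N.InputEdge → F) →ₗ[F] F :=
        { toFun := fun y => sol.φ e he (fun j _ => y j) 0
          map_add' := fun x y =>
            congrFun ((hφ e he).map_add (fun j _ => x j) (fun j _ => y j)) 0
          map_smul' := fun a x => congrFun ((hφ e he).map_smul a (fun j _ => x j)) 0 }
      have hL : L y = c e ⬝ᵥ y := by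
        rw [L.pi_apply_eq_sum_univ y]
        have hce : c e = fun i => L (Pi.single i 1) := dif_neg he
        rw [hce]
        refine Finset.sum_congr rfl fun i _ => ?_
        rw [smul_eq_mul, mul_comm]
        congr 2
        funext j
        simp [Pi.single_apply, eq_comm]
      funext t
      rw [Subsingleton.elim t 0]
      exact hL
    have hzero : ∀ (v : N.V) (y : N.InputEdge → F), (∀ a ∈ N.inSet v, c a ⬝ᵥ y = 0) →
        ((fun i _ => y i.1, fun e => sol.φ e.1 e.2.2 (fun j _ => y j)) :
          (∀ _ : {i : N.InputEdge // N.tl i.1 = v}, Fin 1 → F) ×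
          (∀ _ : {e : N.E // N.tl e = v ∧ ¬ N.IsInput e}, Fin 1 → F)) = 0 := by
      intro v y hy
      refine Prod.ext ?_ ?_
      · funext i t
        have := hy i.1.1 i.2
        rwa [hin, single_one_dotProduct] at this
      · funext e t
        have := hy e.1 e.2.1
        exact (congrFun (hval e.1 e.2.2 y) t).trans this
    refine ⟨c, hin, fun v e he => ?_⟩
    rw [mem_span_image_iff_dotProduct]
    intro y hy
    rcases he with ⟨rfl, he⟩ | he
    · obtain ⟨g, hg, hgx⟩ := hloc e he
      have h := hgx fun j _ => y j
      rw [hzero _ y hy, hg.map_zero, hval] at h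
      exact congrFun h 0
    · obtain ⟨χ, hχ, hχx⟩ := hdec v e he
      have h := hχx fun j _ => y j
      rw [hzero _ y hy, hχ.map_zero] at h
      rw [hin ⟨e, N.demand_isInput v e he⟩, single_one_dotProduct]
      exact (congrFun h 0).symm
  · rintro ⟨c, hc⟩
    have hdec : ∀ (v : N.V) (j : N.E) (hj : j ∈ N.demand v),
        ∃ χ : ((∀ _ : {i : N.InputEdge // N.tl i.1 = v}, Fin 1 → F) ×
          (∀ _ : {e : N.E // N.tl e = v ∧ ¬ N.IsInput e}, Fin 1 → F)) → (Fin 1 → F),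
          IsLinearMap F χ ∧ ∀ x : N.MsgSpace F (fun _ => 1),
            χ (N.received c v x) = x ⟨j, N.demand_isInput v j hj⟩ := by
      intro v j hj
      obtain ⟨g, hg, hgx⟩ := hc.exists_comp_received (Or.inr hj : j ∈ N.outSet v)
      refine ⟨g, hg, fun x => (hgx x).trans ?_⟩
      funext t
      rw [hc.input ⟨j, N.demand_isInput v j hj⟩, single_one_dotProduct, Subsingleton.elim t 0]
    have hloc : ∀ (e : N.E) (_ : ¬ N.IsInput e),
        ∃ g : ((∀ _ : {i : N.InputEdge // N.tl i.1 = N.hd e}, Fin 1 → F) ×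
          (∀ _ : {e' : N.E // N.tl e' = N.hd e ∧ ¬ N.IsInput e'}, Fin 1 → F)) → (Fin 1 → F),
          IsLinearMap F g ∧ ∀ x : N.MsgSpace F (fun _ => 1),
          (fun _ => c e ⬝ᵥ fun i => x i 0) = g (N.received c (N.hd e) x) := by
      intro e he
      obtain ⟨g, hg, hgx⟩ := hc.exists_comp_received (Or.inl ⟨rfl, he⟩ : e ∈ N.outSet (N.hd e))
      exact ⟨g, hg, fun x => (hgx x).symm⟩
    refine ⟨⟨fun e _ x _ => c e ⬝ᵥ fun i => x i 0, fun v j hj => ?_, fun e he => ?_⟩,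
      fun e _ => ⟨fun x y => ?_, fun a x => ?_⟩, hdec, hloc⟩
    · obtain ⟨χ, -, h⟩ := hdec v j hj
      exact ⟨χ, h⟩
    · obtain ⟨g, -, h⟩ := hloc e he
      exact ⟨g, h⟩
    · funext t; exact dotProduct_add _ (fun i => x i 0) (fun i => y i 0)
    · funext t; exact dotProduct_smul a _ (fun i => x i 0)

/-- Edges carrying the zero functional can be reassigned a nonzero one. -/
theorem IsCodingFamily.exists_ne_zero {N : Network} {F : Type} [Field F]
    {c : N.E → N.InputEdge → F} (hc : N.IsCodingFamily c) :
    ∃ c' : N.E → N.InputEdge → F, N.IsCodingFamily c' ∧ ∀ e, c' e ≠ 0 := by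
  obtain ⟨h, hh⟩ := N.acyclic
  have key : ∀ n : ℕ, ∃ c' : N.E → N.InputEdge → F,
      N.IsCodingFamily c' ∧ ∀ e, h (N.hd e) < n → c' e ≠ 0 := by
    intro n
    induction n with
    | zero => exact ⟨c, hc, fun e he => absurd he (Nat.not_lt_zero _)⟩
    | succ n ih =>
      obtain ⟨b, hb, hne⟩ := ih
      have hin : ∀ i : N.InputEdge, b i.1 ≠ 0 := fun i => by simp [hb.input i]
      have hpred : ∀ e : N.E, ∃ e' : N.E,
          b e = 0 ∧ h (N.hd e) = n → N.tl e' = N.hd e ∧ b e' ≠ 0 := by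
        intro e
        by_cases he : b e = 0 ∧ h (N.hd e) = n
        · have hni : ¬ N.IsInput e := fun hi => hin ⟨e, hi⟩ he.1
          simp only [IsInput, not_forall, not_not] at hni
          obtain ⟨e', he'⟩ := hni
          refine ⟨e', fun _ => ⟨he', hne e' ?_⟩⟩
          rw [← he.2, ← he']
          exact hh e'
        · exact ⟨e, fun h' => absurd h' he⟩
      choose p hp using hpred
      let b' : N.E → N.InputEdge → F := fun e =>
        if b e = 0 ∧ h (N.hd e) = n then b (p e) else b e
      have hb' : ∀ e, b e ≠ 0 → b' e = b e := fun e he => if_neg fun h' => he h'.1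
      have hspan : ∀ v, ∀ e ∈ N.inSet v, b e ∈ Submodule.span F (b' '' N.inSet v) := by
        intro v e he
        by_cases h0 : b e = 0
        · rw [h0]; exact Submodule.zero_mem _
        · exact Submodule.subset_span ⟨e, he, hb' e h0⟩
      have hle : ∀ v, Submodule.span F (b '' N.inSet v) ≤ Submodule.span F (b' '' N.inSet v) := by
        intro v
        rw [Submodule.span_le]
        rintro _ ⟨e, he, rfl⟩
        exact hspan v e he
      refine ⟨b', ⟨fun i => (hb' _ (hin i)).trans (hb.input i), fun v e he => ?_⟩, fun e he => ?_⟩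
      · by_cases hz : b e = 0 ∧ h (N.hd e) = n
        · have hv : N.hd e = v := by
            rcases he with he | he
            · exact he.1
            · exact absurd hz.1 (hin ⟨e, N.demand_isInput v e he⟩)
          have : b' e = b (p e) := if_pos hz
          rw [this]
          exact hspan v _ ((hp e hz).1.trans hv)
        · have : b' e = b e := if_neg hz
          rw [this]
          exact hle v (hb.mem_span v e he)
      · by_cases hz : b e = 0 ∧ h (N.hd e) = n
        · have : b' e = b (p e) := if_pos hz
          rw [this]
          exact (hp e hz).2
        · have : b' e = b e := if_neg hz
          rw [this]
          rcases Nat.lt_succ_iff_lt_or_eq.1 he with hlt | heq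
          · exact hne e hlt
          · exact fun h0 => hz ⟨h0, heq⟩
  obtain ⟨c', hc', hne⟩ := key (Finset.univ.sup (fun e => h (N.hd e)) + 1)
  exact ⟨c', hc', fun e => hne e
    (Nat.lt_succ_of_le (Finset.le_sup (f := fun e => h (N.hd e)) (Finset.mem_univ e)))⟩

end Network

theorem finrank_span_union_add_finrank_span_inter_le (K : Type*) {W : Type*} [Field K]
    [AddCommGroup W] [Module K W] [FiniteDimensional K W] {α : Type*} (w : α → W)
    (A B : Set α) :
    Module.finrank K (Submodule.span K (w '' (A ∪ B))) +
        Module.finrank K (Submodule.span K (w '' (A ∩ B))) ≤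
      Module.finrank K (Submodule.span K (w '' A)) +
        Module.finrank K (Submodule.span K (w '' B)) := by
  rw [← Submodule.finrank_sup_add_finrank_inf_eq (Submodule.span K (w '' A)), Set.image_union,
    Submodule.span_union]
  gcongr
  refine Submodule.finrank_mono (le_inf ?_ ?_)
  · exact Submodule.span_mono (Set.image_mono Set.inter_subset_left)
  · exact Submodule.span_mono (Set.image_mono Set.inter_subset_right)

theorem finrank_span_image_le_ncard (K : Type*) {W : Type*} [Field K] [AddCommGroup W]
    [Module K W] {α : Type*} [Finite α] (w : α → W) (A : Set α) :
    Module.finrank K (Submodule.span K (w '' A)) ≤ A.ncard := by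
  have := Fintype.ofFinite (w '' A)
  have h := finrank_span_le_card (R := K) (w '' A)
  rw [← Set.ncard_eq_toFinset_card'] at h
  exact h.trans (Set.ncard_image_le (Set.toFinite A))

theorem span_image_eq_iSup_span_singleton (K : Type*) {W : Type*} [Field K] [AddCommGroup W]
    [Module K W] {α : Type*} (w : α → W) (A : Set α) :
    Submodule.span K (w '' A) = ⨆ i ∈ A, Submodule.span K {w i} := by
  have h : w '' A = ⋃ i ∈ A, {w i} := by
    ext y
    simp [eq_comm]
  rw [h, Submodule.span_iUnion₂]

/-- The matroid of a finite family of vectors. -/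
noncomputable def MatroidOn.ofVectors (K : Type*) {W : Type*} [Field K] [AddCommGroup W]
    [Module K W] [FiniteDimensional K W] {r : ℕ} (w : Fin r → W) : MatroidOn r where
  rk X := Module.finrank K (Submodule.span K (w '' X))
  rk_empty := by rw [Set.image_empty, Submodule.span_empty, finrank_bot]
  rk_mono _ _ h := Submodule.finrank_mono (Submodule.span_mono (Set.image_mono h))
  rk_submodular := finrank_span_union_add_finrank_span_inter_le K w
  rk_le_card := finrank_span_image_le_ncard K w

theorem MatroidOn.representableOver_ofVectors {F : Type} {W : Type*} [Field F]
    [AddCommGroup W] [Module F W] [FiniteDimensional F W] {r : ℕ} (w : Fin r → W)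
    (hw : ∀ i, w i ≠ 0) : (MatroidOn.ofVectors F w).RepresentableOver F := by
  let φ : W ≃ₗ[F] (Fin (Module.finrank F W) → F) := (Module.finBasis F W).equivFun
  refine ⟨Module.finrank F W, fun i => Submodule.span F {φ (w i)}, fun i => ?_, fun X => ?_⟩
  · exact finrank_span_singleton (by simpa using hw i)
  · have h : (⨆ i ∈ X, Submodule.span F {φ (w i)}) =
        (Submodule.span F (w '' X)).map (φ : W →ₗ[F] _) := by
      rw [Submodule.map_span, Set.image_image, span_image_eq_iSup_span_singleton]
      rfl
    rw [h]
    exact LinearEquiv.finrank_map_eq φ _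

theorem MatroidOn.RepresentableOver.exists_vectors {F : Type} [Field F] {r : ℕ}
    {M : MatroidOn r} (hM : M.RepresentableOver F) :
    ∃ (d : ℕ) (w : Fin r → Fin d → F),
      ∀ X, Module.finrank F (Submodule.span F (w '' X)) = M.rk X := by
  obtain ⟨d, V, hV, hrk⟩ := hM
  have hgen : ∀ i, ∃ u : Fin d → F, V i = Submodule.span F {u} := by
    intro i
    obtain ⟨u, -, hu⟩ := finrank_eq_one_iff'.1 (hV i)
    refine ⟨u, le_antisymm (fun x hx => ?_) ?_⟩
    · obtain ⟨a, ha⟩ := hu ⟨x, hx⟩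
      exact Submodule.mem_span_singleton.2 ⟨a, congrArg Subtype.val ha⟩
    · rw [Submodule.span_singleton_le_iff_mem]
      exact u.2
  choose w hw using hgen
  refine ⟨d, w, fun X => ?_⟩
  have h : Submodule.span F (w '' X) = ⨆ i ∈ X, V i := by
    simp only [hw, span_image_eq_iSup_span_singleton]
  rw [h, hrk]

namespace Network

theorem IsCodingFamily.exists_matroidal {N : Network} {F : Type} [Field F]
    {c : N.E → N.InputEdge → F} (hc : N.IsCodingFamily c) (hne : ∀ e, c e ≠ 0) :
    ∃ (r : ℕ) (_ : 0 < r) (M : MatroidOn r), M.RepresentableOver F ∧ N.Matroidal M := by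
  let ε := Fintype.equivFin N.E
  rcases isEmpty_or_nonempty N.E with hE | hE
  · refine ⟨1, one_pos, MatroidOn.ofVectors F (fun _ => (1 : F)),
      MatroidOn.representableOver_ofVectors _ (fun _ => one_ne_zero),
      isEmptyElim, fun i => isEmptyElim i.1, ?_, fun v => ?_⟩
    · have : IsEmpty N.InputEdge := ⟨fun i => isEmptyElim i.1⟩
      rw [MatroidOn.Indep, Set.range_eq_empty, MatroidOn.rk_empty, Set.ncard_empty]
    · congr 1
      simp [Set.eq_empty_of_isEmpty]
  · let M := MatroidOn.ofVectors F (fun i => c (ε.symm i))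
    have hrk : ∀ X : Set N.E, M.rk (ε '' X) = Module.finrank F (Submodule.span F (c '' X)) := by
      intro X
      have h : (fun i => c (ε.symm i)) '' (ε '' X) = c '' X := by
        simp [Set.image_image]
      rw [← h]
      rfl
    refine ⟨Fintype.card N.E, Fintype.card_pos, M,
      MatroidOn.representableOver_ofVectors _ fun i => hne _, ε,
      fun i j h => Subtype.ext (ε.injective h), ?_, fun v => ?_⟩
    · have hinj : Function.Injective fun i : N.InputEdge => ε i.1 :=
        ε.injective.comp Subtype.val_injective
      have hli : LinearIndependent F fun i : N.InputEdge => c i.1 := by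
        simp only [hc.input]
        exact Pi.linearIndependent_single_one _ _
      have h1 : (Set.range fun i : N.InputEdge => ε i.1) =
          ε '' Set.range fun i : N.InputEdge => i.1 := by
        rw [← Set.range_comp]; rfl
      rw [MatroidOn.Indep, ← Set.image_univ, Set.ncard_image_of_injective _ hinj,
        Set.image_univ, h1, hrk, ← Set.range_comp, Set.ncard_univ, Nat.card_eq_fintype_card]
      exact finrank_span_eq_card hli
    · rw [hrk, hrk, Set.image_union, Submodule.span_union, sup_eq_left.2]
      rw [Submodule.span_le]
      rintro _ ⟨e, he, rfl⟩
      exact hc.mem_span v e he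

theorem Matroidal.exists_isCodingFamily {N : Network} {F : Type} [Field F] {r : ℕ}
    {M : MatroidOn r} (hN : N.Matroidal M) (hM : M.RepresentableOver F) :
    ∃ c : N.E → N.InputEdge → F, N.IsCodingFamily c := by
  obtain ⟨d, w, hw⟩ := hM.exists_vectors
  obtain ⟨f, hinj, hind, hv⟩ := hN
  have hinj : Function.Injective fun i : N.InputEdge => f i.1 := fun i j => hinj i j
  have hli : LinearIndependent F fun i : N.InputEdge => w (f i.1) := by
    rw [linearIndependent_iff_card_eq_finrank_span, Set.finrank]
    have h1 : (Set.range fun i : N.InputEdge => w (f i.1)) =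
        w '' Set.range fun i : N.InputEdge => f i.1 := by
      rw [← Set.range_comp]; rfl
    rw [h1, hw, hind, ← Set.image_univ, Set.ncard_image_of_injective _ hinj, Set.ncard_univ,
      Nat.card_eq_fintype_card]
  obtain ⟨T, hT⟩ := LinearMap.exists_leftInverse_of_injective
    (Fintype.linearCombination F fun i : N.InputEdge => w (f i.1))
    (LinearMap.ker_eq_bot.2 hli.fintypeLinearCombination_injective)
  refine ⟨fun e => T (w (f e)), fun i => ?_, fun v e he => ?_⟩
  · have := LinearMap.congr_fun hT (Pi.single i 1)
    simpa [Fintype.linearCombination_apply_single] using this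
  · have heq : Submodule.span F (w '' (f '' N.inSet v)) =
        Submodule.span F (w '' (f '' (N.inSet v ∪ N.outSet v))) := by
      refine Submodule.eq_of_le_of_finrank_eq
        (Submodule.span_mono (Set.image_mono (Set.image_mono Set.subset_union_left))) ?_
      rw [hw, hw, hv]
    have hmem : w (f e) ∈ Submodule.span F (w '' (f '' N.inSet v)) := by
      rw [heq]
      exact Submodule.subset_span ⟨_, ⟨e, Or.inr he, rfl⟩, rfl⟩
    have := Submodule.mem_map_of_mem (f := T) hmem
    rwa [Submodule.map_span, Set.image_image, Set.image_image] at this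

end Network

/-- **Corollary 1.** A network has a scalar linear solution over `F_q` if and only if it is
matroidal with respect to a matroid representable over `F_q`. -/
theorem scalarLinearSolvable_iff_matroidal
    (N : Network) (F : Type) [Field F] [Fintype F] :
    (∃ sol : N.FNCSol F (fun _ => 1) 1, sol.IsLinear) ↔
    ∃ (r : ℕ) (_ : 0 < r) (M : MatroidOn r),
      M.RepresentableOver F ∧ N.Matroidal M := by
  rw [N.exists_isLinear_iff_exists_isCodingFamily]
  constructor
  · rintro ⟨c, hc⟩
    obtain ⟨c, hc, hne⟩ := hc.exists_ne_zero
    exact hc.exists_matroidal hne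
  · rintro ⟨r, -, M, hM, hN⟩
    exact hN.exists_isCodingFamily hM
end

section
/- If a perfect linear index coding solution of dimension n over F_q exists for the index coding problem I^D(Z,R) constructed from a discrete polymatroid D, then the discrete polymatroid nD is representable over F_q. -/
open scoped Classical

/-- An index coding problem with message index type `M`: a receiver `(x, H)` demands the
message `x` and has the set of messages `H` as side information. -/
structure IndexProblem (M : Type) where
  recv : Set (M × Set M)

/-- A linear index coding solution over `F` of length `c` and dimension `n`: each message is
a row vector of length `n` over `F`, the encoding map `f` is linear, and every receiver can
recover its demanded message from its side information and `f(y)` by a linear decoding map. -/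
def HasLinearIndexCode {M : Type} (P : IndexProblem M) (F : Type) [Field F]
    (n c : ℕ) : Prop :=
  ∃ f : ((M → Fin n → F) →ₗ[F] (Fin c → F)),
    ∀ p ∈ P.recv, ∃ ψ : ((↥p.2 → Fin n → F) × (Fin c → F)) →ₗ[F] (Fin n → F),
      ∀ y : M → Fin n → F, ψ (fun j => y j.1, f y) = y p.1

namespace DiscretePolymatroid

variable {r : ℕ} (D : DiscretePolymatroid r)

/-- A basis vector of a discrete polymatroid: a maximal element of the carrier. -/
def IsBasisVec (b : Fin r → ℕ) : Prop :=
  b ∈ D.carrier ∧ ∀ u ∈ D.carrier, (∀ i, b i ≤ u i) → u = b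

/-- An excluded vector of a discrete polymatroid. -/
def IsExcluded (u : Fin r → ℕ) : Prop :=
  (∀ i, u i ≤ D.rho {i}) ∧ u ∉ D.carrier

/-- A minimal excluded vector of a discrete polymatroid. -/
def IsMinExcluded (u : Fin r → ℕ) : Prop :=
  D.IsExcluded u ∧ ∀ v, D.IsExcluded v → (∀ i, v i ≤ u i) → v = u

/-- The message index type of the index coding problem `I^D(Z,R)`:
`Sum.inl j` is the message `x_j` (`j ∈ {1,…,rank D}`), and `Sum.inr ⟨i,p⟩` is the message
`y_i^p` (`i ∈ {1,…,r}`, `p ∈ {1,…,ρ({i})}`). -/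
@[reducible] noncomputable def Msg : Type :=
  Fin D.rank ⊕ (Σ i : Fin r, Fin (D.rho {i}))

/-- The number of elements of a subset `T` of `Y` lying in `ζ_l = {y_l^1,…,y_l^{ρ({l})}}`. -/
noncomputable def sliceCard (T : Set (Σ i : Fin r, Fin (D.rho {i}))) (l : Fin r) : ℕ :=
  {p : Fin (D.rho {l}) | (⟨l, p⟩ : Σ i : Fin r, Fin (D.rho {i})) ∈ T}.ncard

/-- The index coding problem `I^D(Z,R)` constructed from the discrete polymatroid `D`,
with receiver set `R = R1 ∪ R2 ∪ R3`. -/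
noncomputable def indexProblem : IndexProblem D.Msg where
  recv :=
    -- R1
    {pr | ∃ b : Fin r → ℕ, D.IsBasisVec b ∧ ∃ j : Fin D.rank,
        ∃ T : Set (Σ i : Fin r, Fin (D.rho {i})),
          (∀ l : Fin r, D.sliceCard T l = b l) ∧
          pr = (Sum.inl j, Sum.inr '' T)} ∪
    -- R2
    {pr | ∃ c : Fin r → ℕ, D.IsMinExcluded c ∧ ∃ j : Fin r, c j ≠ 0 ∧
        ∃ p : Fin (D.rho {j}), ∃ T : Set (Σ i : Fin r, Fin (D.rho {i})),
          (∀ l : Fin r, l ≠ j → D.sliceCard T l = c l) ∧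
          D.sliceCard T j = c j - 1 ∧
          (⟨j, p⟩ : Σ i : Fin r, Fin (D.rho {i})) ∉ T ∧
          pr = (Sum.inr ⟨j, p⟩, Sum.inr '' T)} ∪
    -- R3
    {pr | ∃ (i : Fin r) (p : Fin (D.rho {i})),
        pr = (Sum.inr ⟨i, p⟩, Set.range Sum.inl)}

/-- `M(I^D(Z,R)) = ∑_{i=1}^r ρ({i})`: a perfect solution of dimension `n` has length
`n * indexCodeLen`. -/
noncomputable def indexCodeLen : ℕ := ∑ i : Fin r, D.rho {i}

/-- The bound `N(D)` on the field size. -/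
noncomputable def Nbound : ℕ :=
  1 + Finset.univ.sup fun i : Fin r =>
    ∑ b ∈ D.finite.toFinset.filter (fun b => D.IsBasisVec b ∧ 0 < b i),
      Nat.choose (D.rho {i}) (b i - 1) *
        ∏ j ∈ (Finset.univ.filter fun j : Fin r => b j ≠ 0).erase i,
          Nat.choose (D.rho {j}) (b j)

end DiscretePolymatroid

section CoordSpan

variable {M F : Type} [Field F] {n : ℕ}

/-- The linear functional on a subspace of the message space reading off the `a`-th symbol of the
message `m`. -/
def coordFunctional (K : Submodule F (M → Fin n → F)) (m : M) (a : Fin n) : Module.Dual F K :=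
  LinearMap.proj a ∘ₗ LinearMap.proj m ∘ₗ K.subtype

/-- The span of the coordinate functionals of the messages in `S`. -/
def coordSpan (K : Submodule F (M → Fin n → F)) (S : Set M) : Submodule F (Module.Dual F K) :=
  Submodule.span F (Set.image2 (coordFunctional K) S Set.univ)

variable {K : Submodule F (M → Fin n → F)}

lemma coordSpan_mono {S T : Set M} (h : S ⊆ T) : coordSpan K S ≤ coordSpan K T :=
  Submodule.span_mono (Set.image2_subset_right h)

lemma coordFunctional_mem_coordSpan {S : Set M} {m : M} (hm : m ∈ S) (a : Fin n) :
    coordFunctional K m a ∈ coordSpan K S :=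
  Submodule.subset_span ⟨m, hm, a, Set.mem_univ a, rfl⟩

lemma coordSpan_le {S : Set M} {W : Submodule F (Module.Dual F K)}
    (h : ∀ m ∈ S, ∀ a, coordFunctional K m a ∈ W) : coordSpan K S ≤ W := by
  refine Submodule.span_le.2 ?_
  rintro _ ⟨m, hm, a, -, rfl⟩
  exact h m hm a

lemma coordSpan_union (S T : Set M) :
    coordSpan K (S ∪ T) = coordSpan K S ⊔ coordSpan K T := by
  rw [coordSpan, Set.image2_union_left, Submodule.span_union, coordSpan, coordSpan]

lemma finrank_coordSpan_le [Finite M] (S : Set M) :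
    Module.finrank F (coordSpan K S) ≤ n * S.ncard := by
  have hfin : (Set.image2 (coordFunctional K) S Set.univ).Finite := Set.toFinite _
  have := hfin.fintype
  refine (finrank_span_le_card _).trans ?_
  rw [← Set.ncard_eq_toFinset_card', ← Set.image_prod]
  refine (Set.ncard_image_le (Set.toFinite _)).trans ?_
  rw [Set.ncard_prod, Set.ncard_univ, Nat.card_eq_fintype_card, Fintype.card_fin, mul_comm]

/-- A functional vanishing wherever all symbols of the messages in `S` vanish lies in their
span. -/
lemma mem_coordSpan_of_forall [Finite M] {S : Set M} {φ : Module.Dual F K}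
    (h : ∀ y : K, (∀ m ∈ S, y.1 m = 0) → φ y = 0) : φ ∈ coordSpan K S := by
  have key : φ ∈ Submodule.span F
      (Set.range fun q : S × Fin n => coordFunctional K q.1.1 q.2) := by
    refine mem_span_of_iInf_ker_le_ker fun y hy => h y fun m hm => funext fun a => ?_
    exact (Submodule.mem_iInf _).1 hy (⟨m, hm⟩, a)
  refine Submodule.span_mono ?_ key
  rintro _ ⟨⟨⟨m, hm⟩, a⟩, rfl⟩
  exact ⟨m, hm, a, Set.mem_univ a, rfl⟩

lemma coordSpan_univ [Finite M] : coordSpan K (Set.univ : Set M) = ⊤ := by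
  refine eq_top_iff.2 fun φ _ => mem_coordSpan_of_forall fun y hy => ?_
  have : y = 0 := Subtype.ext (funext fun m => hy m (Set.mem_univ m))
  rw [this, map_zero]

/-- On the kernel of the encoding map, a decodable message lies in the span of the side
information. -/
lemma coordFunctional_mem_coordSpan_of_decode [Finite M] {c : ℕ}
    {f : (M → Fin n → F) →ₗ[F] (Fin c → F)} {m : M} {H : Set M}
    (h : ∃ ψ : ((↥H → Fin n → F) × (Fin c → F)) →ₗ[F] (Fin n → F),
      ∀ y : M → Fin n → F, ψ (fun j => y j.1, f y) = y m) (a : Fin n) :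
    coordFunctional (LinearMap.ker f) m a ∈ coordSpan (LinearMap.ker f) H := by
  obtain ⟨ψ, hψ⟩ := h
  refine mem_coordSpan_of_forall fun y hy => ?_
  have hzero : ((fun j : H => y.1 j.1), f y.1) = 0 :=
    Prod.ext (funext fun j => hy j.1 j.2) (LinearMap.mem_ker.1 y.2)
  have := hψ y.1
  rw [hzero, map_zero] at this
  exact (congrFun this a).symm

end CoordSpan

namespace DiscretePolymatroid

variable {r : ℕ} (D : DiscretePolymatroid r)

lemma setSum_le_rho_s4 {u : Fin r → ℕ} (hu : u ∈ D.carrier) (A : Set (Fin r)) :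
    setSum u A ≤ D.rho A :=
  Finset.le_sup (f := fun u => setSum u A) (D.finite.mem_toFinset.2 hu)

lemma exists_setSum_eq_rho (A : Set (Fin r)) : ∃ u ∈ D.carrier, setSum u A = D.rho A := by
  obtain ⟨u, hu, h⟩ := Finset.exists_mem_eq_sup D.finite.toFinset
    (D.finite.toFinset_nonempty.2 D.nonempty) fun u => setSum u A
  exact ⟨u, D.finite.mem_toFinset.1 hu, h.symm⟩

lemma le_rho_singleton {u : Fin r → ℕ} (hu : u ∈ D.carrier) (i : Fin r) :
    u i ≤ D.rho {i} := by
  simpa [setSum, Finset.filter_eq'] using D.setSum_le_rho_s4 hu {i}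

lemma exists_isBasisVec_ge {u : Fin r → ℕ} (hu : u ∈ D.carrier) :
    ∃ b, D.IsBasisVec b ∧ ∀ i, u i ≤ b i := by
  obtain ⟨b, hub, hb⟩ := D.finite.exists_le_maximal hu
  exact ⟨b, ⟨hb.prop, fun v hv hbv => le_antisymm (hb.le_of_ge hv hbv) hbv⟩, hub⟩

variable {D} in
lemma IsBasisVec.sum_eq_rank {b : Fin r → ℕ} (hb : D.IsBasisVec b) : ∑ i, b i = D.rank := by
  refine le_antisymm (by simpa [setSum, rank] using D.setSum_le_rho_s4 hb.1 Set.univ) ?_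
  obtain ⟨v, hv, hsum⟩ := D.exists_setSum_eq_rho Set.univ
  by_contra! hlt
  obtain ⟨w, hw, hbw, hne, -⟩ := D.exchange b hb.1 v hv (by
    simpa [setSum, rank] using hlt.trans_eq hsum.symm)
  exact hne (hb.2 w hw hbw).symm

lemma exists_isBasisVec_setSum_eq_rho (A : Set (Fin r)) :
    ∃ b, D.IsBasisVec b ∧ setSum b A = D.rho A := by
  obtain ⟨u, hu, hsum⟩ := D.exists_setSum_eq_rho A
  obtain ⟨b, hb, hub⟩ := D.exists_isBasisVec_ge hu
  exact ⟨b, hb, le_antisymm (D.setSum_le_rho_s4 hb.1 A)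
    (hsum ▸ Finset.sum_le_sum fun i _ => hub i)⟩

variable {D} in
lemma IsExcluded.exists_isMinExcluded_le {u : Fin r → ℕ} (hu : D.IsExcluded u) :
    ∃ c, D.IsMinExcluded c ∧ ∀ i, c i ≤ u i := by
  obtain ⟨c, hcu, hc⟩ := exists_minimal_le_of_wellFoundedLT D.IsExcluded u hu
  exact ⟨c, ⟨hc.prop, fun v hv hvc => le_antisymm hvc (hc.le_of_le hv hvc)⟩, hcu⟩

/-- The first `u l` messages of each `ζ_l`. -/
def initialMsgs (u : Fin r → ℕ) : Set (Σ i : Fin r, Fin (D.rho {i})) :=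
  {q | q.2.val < u q.1}

lemma initialMsgs_mono {u v : Fin r → ℕ} (h : ∀ i, u i ≤ v i) :
    D.initialMsgs u ⊆ D.initialMsgs v :=
  fun q hq => lt_of_lt_of_le hq (h q.1)

lemma sliceCard_initialMsgs {u : Fin r → ℕ} {l : Fin r} (h : u l ≤ D.rho {l}) :
    D.sliceCard (D.initialMsgs u) l = u l := by
  have : {p : Fin (D.rho {l}) | (⟨l, p⟩ : Σ i : Fin r, Fin (D.rho {i})) ∈ D.initialMsgs u} =
      Set.range (Fin.castLE h) := by
    ext p
    exact ⟨fun hp => ⟨⟨p, hp⟩, rfl⟩, by rintro ⟨q, rfl⟩; exact q.2⟩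
  rw [sliceCard, this, ← Set.image_univ,
    Set.ncard_image_of_injective _ (Fin.castLE_injective h), Set.ncard_univ,
    Nat.card_eq_fintype_card, Fintype.card_fin]

lemma ncard_initialMsgs_le (u : Fin r → ℕ) : (D.initialMsgs u).ncard ≤ ∑ i, u i := by
  have h : Nat.card (D.initialMsgs u) ≤ Nat.card (Σ i : Fin r, Fin (u i)) := by
    refine Nat.card_le_card_of_injective (fun q => ⟨q.1.1, ⟨q.1.2.val, q.2⟩⟩) ?_
    rintro ⟨⟨i, p⟩, hp⟩ ⟨⟨j, q⟩, hq⟩ hpq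
    obtain ⟨rfl, hpq⟩ := Sigma.mk.inj_iff.1 hpq
    have := congrArg Fin.val (eq_of_heq hpq)
    exact Subtype.ext (congrArg (Sigma.mk i) (Fin.ext this))
  rw [Nat.card_coe_set_eq] at h
  simpa using h

variable {F : Type} [Field F] {n : ℕ}

lemma mul_rank_le_finrank_ker
    (f : (D.Msg → Fin n → F) →ₗ[F] (Fin (n * D.indexCodeLen) → F)) :
    n * D.rank ≤ Module.finrank F (LinearMap.ker f) := by
  have h1 := f.finrank_range_add_finrank_ker
  have h2 := (LinearMap.range f).finrank_le
  have h3 : Module.finrank F (D.Msg → Fin n → F) = n * D.rank + n * D.indexCodeLen := by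
    rw [Module.finrank_pi_fintype]
    simp [Msg, indexCodeLen, mul_add, mul_comm]
  rw [Module.finrank_fin_fun] at h2
  omega

section Solution

variable {D} {K : Submodule F (D.Msg → Fin n → F)}

/-- Restricted to `K`, the message demanded by each receiver of `I^D(Z,R)` lies in the span of its
side information. -/
abbrev Decodes (K : Submodule F (D.Msg → Fin n → F)) : Prop :=
  ∀ p ∈ D.indexProblem.recv, ∀ a, coordFunctional K p.1 a ∈ coordSpan K p.2

lemma Decodes.coordSpan_basis (hK : Decodes K) {b : Fin r → ℕ} (hb : D.IsBasisVec b) :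
    coordSpan K (Sum.inr '' D.initialMsgs b) = ⊤ := by
  have hx : ∀ j a, coordFunctional K (Sum.inl j) a ∈
      coordSpan K (Sum.inr '' D.initialMsgs b) := fun j a =>
    hK (Sum.inl j, Sum.inr '' D.initialMsgs b) (Or.inl (Or.inl ⟨b, hb, j, _, fun l =>
      D.sliceCard_initialMsgs (D.le_rho_singleton hb.1 l), rfl⟩)) a
  rw [eq_top_iff, ← coordSpan_univ]
  refine coordSpan_le fun m _ a => ?_
  rcases m with j | ⟨i, p⟩
  · exact hx j a
  · refine coordSpan_le (fun m hm a => ?_)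
      (hK (Sum.inr ⟨i, p⟩, Set.range Sum.inl) (Or.inr ⟨i, p, rfl⟩) a)
    obtain ⟨j, rfl⟩ := hm
    exact hx j a

/-- The vector `b` with the components outside `X` replaced by zero. -/
noncomputable def restrict (b : Fin r → ℕ) (X : Set (Fin r)) : Fin r → ℕ :=
  fun i => if i ∈ X then b i else 0

lemma restrict_of_mem (b : Fin r → ℕ) {X : Set (Fin r)} {i : Fin r} (hi : i ∈ X) :
    restrict b X i = b i :=
  if_pos hi

lemma restrict_of_notMem (b : Fin r → ℕ) {X : Set (Fin r)} {i : Fin r} (hi : i ∉ X) :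
    restrict b X i = 0 :=
  if_neg hi

lemma sum_restrict (b : Fin r → ℕ) (X : Set (Fin r)) : ∑ i, restrict b X i = setSum b X := by
  simp [restrict, setSum, Finset.sum_filter]

lemma Decodes.coordFunctional_mem (hK : Decodes K) {b : Fin r → ℕ} (hb : D.IsBasisVec b)
    {X : Set (Fin r)} (hX : setSum b X = D.rho X) {i : Fin r} (hi : i ∈ X)
    (p : Fin (D.rho {i})) (a : Fin n) :
    coordFunctional K (Sum.inr ⟨i, p⟩) a ∈
      coordSpan K (Sum.inr '' D.initialMsgs (restrict b X)) := by
  have hri : restrict b X i = b i := restrict_of_mem b hi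
  have hle : ∀ l, restrict b X l ≤ b l := fun l => by
    unfold restrict; split_ifs <;> omega
  by_cases hp : p.val < b i
  · have hmem : (⟨i, p⟩ : Σ i : Fin r, Fin (D.rho {i})) ∈ D.initialMsgs (restrict b X) :=
      hp.trans_eq hri.symm
    exact coordFunctional_mem_coordSpan (Set.mem_image_of_mem Sum.inr hmem) a
  have hexc : D.IsExcluded (Function.update (restrict b X) i (b i + 1)) := by
    refine ⟨fun l => ?_, fun hmem => ?_⟩
    · rcases eq_or_ne l i with rfl | hl
      · have := p.2
        simp only [Function.update_self]
        omega
      · simpa [hl] using (hle l).trans (D.le_rho_singleton hb.1 l)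
    · have h1 := D.setSum_le_rho_s4 hmem X
      rw [← hX] at h1
      refine h1.not_gt (Finset.sum_lt_sum (fun l hl => ?_) ⟨i, by simpa using hi, by simp⟩)
      rcases eq_or_ne l i with rfl | hne
      · simp
      · simp [hne, restrict, (Finset.mem_filter.1 hl).2]
  obtain ⟨c, hc, hcu⟩ := hexc.exists_isMinExcluded_le
  have hcl : ∀ l, l ≠ i → c l ≤ restrict b X l := fun l hl => by simpa [hl] using hcu l
  have hci : c i = b i + 1 := by
    refine le_antisymm (by simpa using hcu i) ?_
    by_contra! hlt
    refine hc.1.2 (D.lower b hb.1 c fun l => ?_)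
    rcases eq_or_ne l i with rfl | hl
    · omega
    · exact (hcl l hl).trans (hle l)
  set v := Function.update c i (b i) with hv
  have hvle : ∀ l, v l ≤ restrict b X l := fun l => by
    rcases eq_or_ne l i with rfl | hl
    · simp [hv, hri]
    · simpa [hv, hl] using hcl l hl
  have hslice : ∀ l, D.sliceCard (D.initialMsgs v) l = v l := fun l =>
    D.sliceCard_initialMsgs (((hvle l).trans (hle l)).trans (D.le_rho_singleton hb.1 l))
  refine coordSpan_mono (Set.image_mono (D.initialMsgs_mono hvle))
    (hK (Sum.inr ⟨i, p⟩, Sum.inr '' D.initialMsgs v) (Or.inl (Or.inr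
      ⟨c, hc, i, by omega, p, _, fun l hl => ?_, ?_, ?_, rfl⟩)) a)
  · rw [hslice, hv, Function.update_of_ne hl]
  · rw [hslice, hv, Function.update_self, hci, Nat.add_sub_cancel]
  · simpa [initialMsgs, hv] using hp

lemma Decodes.finrank_coordSpan (hK : Decodes K) (hrank : n * D.rank ≤ Module.finrank F K)
    (X : Set (Fin r)) :
    Module.finrank F (coordSpan K (Sum.inr '' {q | q.1 ∈ X})) = n * D.rho X := by
  obtain ⟨b, hb, hX⟩ := D.exists_isBasisVec_setSum_eq_rho X
  have hspan : coordSpan K (Sum.inr '' {q | q.1 ∈ X}) =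
      coordSpan K (Sum.inr '' D.initialMsgs (restrict b X)) := by
    refine le_antisymm (coordSpan_le ?_) (coordSpan_mono (Set.image_mono fun q hq => ?_))
    · rintro _ ⟨⟨i, p⟩, hi, rfl⟩ a
      exact hK.coordFunctional_mem hb hX hi p a
    · by_contra hqX
      exact absurd (LT.lt.trans_eq hq (restrict_of_notMem b hqX)) (Nat.not_lt_zero _)
  have hcard : ∀ A : Set (Fin r),
      Module.finrank F (coordSpan K (Sum.inr '' D.initialMsgs (restrict b A))) ≤
        n * setSum b A := fun A =>
    (finrank_coordSpan_le _).trans (Nat.mul_le_mul_left n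
      (((Set.ncard_image_le (Set.toFinite _)).trans (D.ncard_initialMsgs_le _)).trans_eq
        (sum_restrict b A)))
  have htop : coordSpan K (Sum.inr '' D.initialMsgs (restrict b X)) ⊔
      coordSpan K (Sum.inr '' D.initialMsgs (restrict b Xᶜ)) = ⊤ := by
    rw [← coordSpan_union, ← Set.image_union, eq_top_iff, ← hK.coordSpan_basis hb]
    refine coordSpan_mono (Set.image_mono fun q hq => ?_)
    by_cases hqX : q.1 ∈ X
    · exact Or.inl (LT.lt.trans_eq hq (restrict_of_mem b hqX).symm)
    · exact Or.inr (LT.lt.trans_eq hq (restrict_of_mem b hqX).symm)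
  have hsum : setSum b X + setSum b Xᶜ = D.rank := by
    rw [← hb.sum_eq_rank]
    simpa [setSum] using Finset.sum_filter_add_sum_filter_not Finset.univ (· ∈ X) b
  have h1 := Submodule.finrank_add_le_finrank_add_finrank
    (coordSpan K (Sum.inr '' D.initialMsgs (restrict b X)))
    (coordSpan K (Sum.inr '' D.initialMsgs (restrict b Xᶜ)))
  rw [htop, finrank_top, Subspace.dual_finrank_eq] at h1
  have h2 := hcard X
  have h3 := hcard Xᶜ
  rw [← hsum, mul_add] at hrank
  rw [hspan, ← hX]
  omega

end Solution

end DiscretePolymatroid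

lemma iSup_coordSpan_fiber {r : ℕ} {D : DiscretePolymatroid r} {F : Type} [Field F] {n : ℕ}
    (K : Submodule F (D.Msg → Fin n → F)) (X : Set (Fin r)) :
    ⨆ i ∈ X, coordSpan K (Sum.inr '' {q | q.1 = i}) =
      coordSpan K (Sum.inr '' {q | q.1 ∈ X}) := by
  refine le_antisymm (iSup₂_le fun i hi => coordSpan_mono (Set.image_mono ?_))
    (coordSpan_le fun m hm a => ?_)
  · rintro q rfl
    exact hi
  · obtain ⟨q, hq, rfl⟩ := hm
    exact Submodule.mem_iSup_of_mem q.1 (Submodule.mem_iSup_of_mem hq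
      (coordFunctional_mem_coordSpan (Set.mem_image_of_mem Sum.inr (by rfl)) a))

/-- A representation inside any finite-dimensional space gives one inside `F^d`. -/
lemma repFnOver_of_finrank_eq {r : ℕ} {ρ' : Set (Fin r) → ℕ} {F E : Type} [Field F]
    [AddCommGroup E] [Module F E] [FiniteDimensional F E] (V : Fin r → Submodule F E)
    (h : ∀ X : Set (Fin r), Module.finrank F ↥(⨆ i ∈ X, V i) = ρ' X) : RepFnOver r ρ' F := by
  let e := (Module.finBasis F E).equivFun
  refine ⟨_, fun i => (V i).map e.toLinearMap, fun X => ?_⟩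
  have hmap : ⨆ i ∈ X, (V i).map e.toLinearMap = (⨆ i ∈ X, V i).map e.toLinearMap := by
    simp only [Submodule.map_iSup]
  rw [hmap, ← h X]
  exact e.finrank_map_eq _

/-- **Theorem 7.** If a perfect linear index coding solution of dimension `n` over `F_q`
exists for the index coding problem `I^D(Z,R)`, then the discrete polymatroid `nD`
(with rank function `X ↦ n·ρ(X)`) is representable over `F_q`. -/
theorem representable_of_perfectLinearIndexCode
    {r : ℕ} (hr : 0 < r) (D : DiscretePolymatroid r) (n : ℕ) (hn : 0 < n)
    (F : Type) [Field F] [Fintype F]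
    (h : HasLinearIndexCode D.indexProblem F n (n * D.indexCodeLen)) :
    RepFnOver r (fun X => n * D.rho X) F := by
  obtain ⟨f, hf⟩ := h
  refine repFnOver_of_finrank_eq
    (fun i => coordSpan (LinearMap.ker f) (Sum.inr '' {q | q.1 = i})) fun X => ?_
  rw [iSup_coordSpan_fiber]
  exact DiscretePolymatroid.Decodes.finrank_coordSpan
    (fun p hp => coordFunctional_mem_coordSpan_of_decode (hf p hp))
    (D.mul_rank_le_finrank_ker f) X
end
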